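/- Let n ≥ 2, s ∈ (0,1), γ > −n, q ≥ 2 with 0 ≤ γ + 2s ≤ q, and let p ∈ [0, n−1). Assume f : ℝⁿ → [0,∞) is measurable with ∫_{ℝⁿ} f(v) dv ≤ M₀, ∫_{ℝⁿ} f(v)|v|^q dv ≤ M_q, and sup_{v ∈ ℝⁿ} (1+|v|)^p f(v) ≤ N < ∞. Let v₀ ∈ ℝⁿ and set M := {h ∈ ℝⁿ : |v + h| < |v₀|/8 and |h| > 1/2 + |v₀|/8}. Then there exists C > 0, depending only on n, p, γ, M₀, M_q, q (independent of v₀, s), such that for every v in the ball B₁(v₀): ∫_M f(v+h) K_f(v, v+h) dh ≤ C (1 + |v₀|)^{−p+γ} N, where K_f is the normalized Boltzmann-type kernel. -/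

import Mathlib

open MeasureTheory Metric Set
open scoped ENNReal RealInnerProductSpace NNReal

noncomputable section

/-- `ℝⁿ` -/
abbrev En (n : ℕ) := EuclideanSpace ℝ (Fin n)

/-- The mean velocity `v̄ = (∫ f v dv) / (∫ f dv)`. -/
def vbar {n : ℕ} (f : En n → ℝ) : En n := (∫ v, f v)⁻¹ • ∫ v, f v • v

/-- Mass bounds `m₀ ≤ ∫ f ≤ M₀`. -/
def MassBound {n : ℕ} (f : En n → ℝ) (m₀ M₀ : ℝ) : Prop :=
  ENNReal.ofReal m₀ ≤ (∫⁻ v, ENNReal.ofReal (f v)) ∧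
    (∫⁻ v, ENNReal.ofReal (f v)) ≤ ENNReal.ofReal M₀

/-- Pressure lower bound:
`inf_{σ ∈ S^{n-1}} sup_{e ∈ S^{n-1}, e ⊥ σ} ∫ f(v̄+w) |w·e|² dw ≥ p₀`,
written via the ε-characterization of the supremum. -/
def PressureLB {n : ℕ} (f : En n → ℝ) (p₀ : ℝ) : Prop :=
  ∀ σ : En n, ‖σ‖ = 1 → ∀ ε : ℝ, 0 < ε → ∃ e : En n, ‖e‖ = 1 ∧ ⟪e, σ⟫ = 0 ∧
    ENNReal.ofReal (p₀ - ε) ≤ ∫⁻ w, ENNReal.ofReal (f (vbar f + w) * ⟪w, e⟫ ^ 2)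

/-- Moment bound `∫ f(v) |v|^q dv ≤ M_q`. -/
def MomentBound {n : ℕ} (f : En n → ℝ) (q Mq : ℝ) : Prop :=
  (∫⁻ v, ENNReal.ofReal (f v * ‖v‖ ^ q)) ≤ ENNReal.ofReal Mq

/-- The normalized Boltzmann-type kernel
`K_f(v,v') = (1-s)|v'-v|^{-n-2s} ∫_{w ⊥ v'-v} f(v+w)|w|^{γ+2s+1} dw`,
with values in `[0,∞]`; the hyperplane integral is taken with respect to the
`(n-1)`-dimensional Hausdorff (i.e. Lebesgue) measure on the hyperplane through the origin
orthogonal to `v' - v`. -/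
def KfE (n : ℕ) (s γ : ℝ) (f : En n → ℝ) (v v' : En n) : ℝ≥0∞ :=
  ENNReal.ofReal ((1 - s) * ‖v' - v‖ ^ (-(n:ℝ) - 2*s)) *
    ∫⁻ w in {w : En n | ⟪w, v' - v⟫ = 0},
      ENNReal.ofReal (f (v + w) * ‖w‖ ^ (γ + 2*s + 1)) ∂μH[(n:ℝ) - 1]

/-- The ratio of the `d`-dimensional Hausdorff measure on `ℝᵈ` to Lebesgue measure. -/
def hausdorffScale (d : ℕ) : ℝ≥0 :=
  Measure.addHaarScalarFactor (μH[(d : ℝ)] : Measure (En d)) volume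

theorem hausdorffMeasure_eq_smul_volume (d : ℕ) :
    (μH[(d : ℝ)] : Measure (En d)) = hausdorffScale d • volume := by
  have : (μH[(d : ℝ)] : Measure (En d)).IsAddHaarMeasure := by
    simpa using MeasureTheory.isAddHaarMeasure_hausdorffMeasure (E := En d)
  exact Measure.isAddLeftInvariant_eq_smul _ _

/-- The isometric embedding of `ℝᵈ` onto the span of all but the first vector of an orthonormal
basis of `ℝᵈ⁺¹`. -/
def hyperplaneEmbed {d : ℕ} (b : OrthonormalBasis (Fin (d + 1)) ℝ (En (d + 1))) (y : En d) :
    En (d + 1) :=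
  b.repr.symm (WithLp.toLp 2 (Fin.cons 0 y))

theorem isometry_hyperplaneEmbed {d : ℕ} (b : OrthonormalBasis (Fin (d + 1)) ℝ (En (d + 1))) :
    Isometry (hyperplaneEmbed b) := by
  refine Isometry.of_dist_eq fun x y => ?_
  simp [hyperplaneEmbed, EuclideanSpace.dist_eq, Fin.sum_univ_succ]

theorem hyperplaneEmbed_eq_sum {d : ℕ} (b : OrthonormalBasis (Fin (d + 1)) ℝ (En (d + 1)))
    (y : En d) : hyperplaneEmbed b y = ∑ j, y j • b j.succ := by
  rw [hyperplaneEmbed, ← b.sum_repr_symm]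
  simp [Fin.sum_univ_succ]

theorem exists_orthonormalBasis_zero_eq {d : ℕ} {h : En (d + 1)} (hh : h ≠ 0) :
    ∃ b : OrthonormalBasis (Fin (d + 1)) ℝ (En (d + 1)), b 0 = ‖h‖⁻¹ • h := by
  obtain ⟨b, hb⟩ := Orthonormal.exists_orthonormalBasis_extension_of_card_eq (𝕜 := ℝ)
    (E := En (d + 1)) (ι := Fin (d + 1)) (by simp) (v := fun _ => ‖h‖⁻¹ • h) (s := {0}) (by
      refine ⟨fun i => ?_, fun i j hij => absurd (Subsingleton.elim i j) hij⟩
      simp [norm_smul, hh])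
  exact ⟨b, hb 0 rfl⟩

theorem range_hyperplaneEmbed {d : ℕ} {b : OrthonormalBasis (Fin (d + 1)) ℝ (En (d + 1))}
    {h : En (d + 1)} (hh : h ≠ 0) (hb : b 0 = ‖h‖⁻¹ • h) :
    range (hyperplaneEmbed b) = {w | ⟪w, h⟫ = 0} := by
  have key : ∀ w, ⟪w, h⟫ = 0 ↔ b.repr w 0 = 0 := fun w => by
    rw [b.repr_apply_apply, hb, real_inner_smul_left, real_inner_comm]
    simp [hh]
  ext w
  rw [mem_ofPred_eq, key]
  constructor
  · rintro ⟨y, rfl⟩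
    simp [hyperplaneEmbed]
  · intro hw
    refine ⟨WithLp.toLp 2 (fun j => b.repr w j.succ), ?_⟩
    rw [hyperplaneEmbed, LinearIsometryEquiv.symm_apply_eq]
    ext i
    refine Fin.cases ?_ (fun j => ?_) i <;> simp [hw]

theorem lintegral_hyperplane_eq_lintegral_embed {d : ℕ}
    {b : OrthonormalBasis (Fin (d + 1)) ℝ (En (d + 1))}
    {h : En (d + 1)} (hh : h ≠ 0) (hb : b 0 = ‖h‖⁻¹ • h) {G : En (d + 1) → ℝ≥0∞}
    (hG : Measurable G) :
    ∫⁻ w in {w | ⟪w, h⟫ = 0}, G w ∂μH[(d : ℝ)] =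
      hausdorffScale d * ∫⁻ y, G (hyperplaneEmbed b y) := by
  have hi := isometry_hyperplaneEmbed b
  rw [← range_hyperplaneEmbed hh hb, ← hi.map_hausdorffMeasure (Or.inl d.cast_nonneg),
    lintegral_map hG hi.continuous.measurable, hausdorffMeasure_eq_smul_volume,
    lintegral_smul_measure]
  rfl

/-- The complementary minor of the corner entry of an orthogonal matrix. -/
theorem abs_det_submatrix_succ {d : ℕ} {A : Matrix (Fin (d + 1)) (Fin (d + 1)) ℝ}
    (hA : A * A.transpose = 1) : |(A.submatrix Fin.succ Fin.succ).det| = |A 0 0| := by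
  have h1 : A.adjugate = A.det • A.transpose := by
    rw [← mul_one A.adjugate, ← hA, ← mul_assoc, Matrix.adjugate_mul, Matrix.smul_mul, one_mul]
  have h2 := congr_fun (congr_fun h1 0) 0
  rw [Matrix.adjugate_fin_succ_eq_det_submatrix] at h2
  have h3 : |A.det| = 1 := by
    have := congrArg Matrix.det hA
    rw [Matrix.det_mul, Matrix.det_transpose, Matrix.det_one, ← sq] at this
    rw [← sq_abs] at this
    nlinarith [abs_nonneg A.det, sq_nonneg (|A.det| - 1)]
  have h4 : (A.submatrix Fin.succ Fin.succ).det = A.det * A 0 0 := by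
    simpa using h2
  rw [h4, abs_mul, h3, one_mul]

/-- The vector of `h^⊥` whose coordinates, the first one excepted, are `y`. -/
def hyperplaneGraph {d : ℕ} (h : En (d + 1)) (y : Fin d → ℝ) : En (d + 1) :=
  WithLp.toLp 2 (Fin.cons (-(∑ k, h k.succ * y k) / h 0) y)

theorem lintegral_hyperplane_eq_lintegral_graph {d : ℕ} {h : En (d + 1)} (hh : h 0 ≠ 0)
    {G : En (d + 1) → ℝ≥0∞} (hG : Measurable G) :
    ∫⁻ w in {w | ⟪w, h⟫ = 0}, G w ∂μH[(d : ℝ)] =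
      hausdorffScale d * (ENNReal.ofReal (‖h‖ / |h 0|) * ∫⁻ y, G (hyperplaneGraph h y)) := by
  have hne : h ≠ 0 := by rintro rfl; simp at hh
  have hpos : 0 < ‖h‖ := norm_pos_iff.2 hne
  obtain ⟨b, hb⟩ := exists_orthonormalBasis_zero_eq hne
  rw [lintegral_hyperplane_eq_lintegral_embed hne hb hG]
  congr 1
  let A : Matrix (Fin (d + 1)) (Fin (d + 1)) ℝ := Matrix.of fun i j => b i j
  have hA : A * A.transpose = 1 := by
    ext i j
    have := orthonormal_iff_ite.1 b.orthonormal i j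
    rw [Matrix.one_apply, ← this, Matrix.mul_apply, PiLp.inner_apply]
    simp [A, mul_comm]
  let S : Matrix (Fin d) (Fin d) ℝ := (A.submatrix Fin.succ Fin.succ).transpose
  have hS : |S.det| = |h 0| / ‖h‖ := by
    rw [Matrix.det_transpose, abs_det_submatrix_succ hA]
    simp [A, hb, abs_mul]
    ring
  have hS0 : S.det ≠ 0 := by
    rw [← abs_pos, hS]; positivity
  have hgraph : ∀ y : Fin d → ℝ,
      hyperplaneEmbed b (WithLp.toLp 2 y) = hyperplaneGraph h (Matrix.toLin' S y) := by
    intro y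
    have htail : ∀ k : Fin d,
        hyperplaneEmbed b (WithLp.toLp 2 y) k.succ = Matrix.toLin' S y k := by
      intro k
      rw [hyperplaneEmbed_eq_sum]
      simp [S, A, Matrix.toLin'_apply, Matrix.mulVec, dotProduct, mul_comm]
    have hperp : ⟪hyperplaneEmbed b (WithLp.toLp 2 y), h⟫ = 0 := by
      have : hyperplaneEmbed b (WithLp.toLp 2 y) ∈ range (hyperplaneEmbed b) := mem_range_self _
      rwa [range_hyperplaneEmbed hne hb] at this
    rw [PiLp.inner_apply, Fin.sum_univ_succ] at hperp
    ext i
    refine Fin.cases ?_ (fun j => ?_) i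
    · simp only [htail] at hperp
      simp only [hyperplaneGraph, Fin.cons_zero]
      rw [eq_div_iff hh]
      simp only [RCLike.inner_apply, conj_trivial] at hperp
      linarith
    · simp [hyperplaneGraph, htail]
  have hmeas : Measurable fun y : Fin d → ℝ => G (hyperplaneGraph h y) := by
    refine hG.comp ((WithLp.measurable_toLp 2 _).comp ?_)
    refine measurable_pi_iff.2 fun i => ?_
    refine Fin.cases ?_ (fun j => ?_) i
    · simp only [Fin.cons_zero]; fun_prop
    · simp only [Fin.cons_succ]; fun_prop
  refine ((PiLp.volume_preserving_toLp (Fin d)).lintegral_comp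
    (hG.comp (isometry_hyperplaneEmbed b).continuous.measurable)).symm.trans ?_
  simp only [Function.comp, hgraph]
  rw [← lintegral_map hmeas (LinearMap.continuous_of_finiteDimensional _).measurable,
    Real.map_matrix_volume_pi_eq_smul_volume_pi hS0, lintegral_smul_measure, abs_inv, hS, inv_div]
  rfl

theorem lintegral_inv_abs_mul_neg_div {a : ℝ} (ha : a ≠ 0) (g : ℝ → ℝ → ℝ≥0∞) :
    ∫⁻ u, ENNReal.ofReal |u|⁻¹ * g (-a / u) u = ∫⁻ t, ENNReal.ofReal |t|⁻¹ * g t (-a / t) := by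
  have himg : (fun t : ℝ => -a / t) '' {0}ᶜ = {0}ᶜ := by
    ext u
    constructor
    · rintro ⟨t, ht, rfl⟩
      exact div_ne_zero (neg_ne_zero.2 ha) ht
    · intro hu
      exact ⟨-a / u, div_ne_zero (neg_ne_zero.2 ha) hu, div_div_cancel₀ (neg_ne_zero.2 ha)⟩
  have h := lintegral_image_eq_lintegral_abs_deriv_mul (s := ({0}ᶜ : Set ℝ))
    (f := fun t => -a / t) (f' := fun t => a / t ^ 2) (measurableSet_singleton 0).compl
    (fun t ht => by
      have ht0 : t ≠ 0 := ht
      simp only [div_eq_mul_inv]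
      exact (((hasDerivAt_inv ht0).const_mul (-a)).congr_deriv (by ring)).hasDerivWithinAt)
    (fun t ht u hu htu => by
      have ht0 : t ≠ 0 := ht
      have hu0 : u ≠ 0 := hu
      simp only at htu
      rw [div_eq_div_iff ht0 hu0] at htu
      exact (mul_left_cancel₀ (neg_ne_zero.2 ha) htu).symm)
    (fun u => ENNReal.ofReal |u|⁻¹ * g (-a / u) u)
  rw [himg, restrict_compl_singleton] at h
  rw [h]
  refine lintegral_congr_ae ?_
  filter_upwards [Measure.ae_ne volume (0 : ℝ)] with t ht
  rw [← mul_assoc, ← ENNReal.ofReal_mul (abs_nonneg _),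
    div_div_cancel₀ (neg_ne_zero.2 ha)]
  congr 2
  rw [abs_div, abs_div, abs_neg, abs_pow]
  have := abs_pos.2 ha
  have := abs_pos.2 ht
  field_simp

/-- The vector of `ℝᵈ⁺¹` with first coordinate `t` and remaining coordinates `x`. -/
def consVec {d : ℕ} (t : ℝ) (x : Fin d → ℝ) : En (d + 1) := WithLp.toLp 2 (Fin.cons t x)

@[fun_prop]
theorem measurable_consVec {α : Type*} [MeasurableSpace α] {d : ℕ} {t : α → ℝ}
    {x : α → Fin d → ℝ} (ht : Measurable t) (hx : Measurable x) :
    Measurable fun a => consVec (t a) (x a) := by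
  refine (WithLp.measurable_toLp 2 _).comp (measurable_pi_iff.2 fun i => ?_)
  refine Fin.cases ?_ (fun j => ?_) i
  · simpa only [Fin.cons_zero] using ht
  · simp only [Fin.cons_succ]; fun_prop

theorem hyperplaneGraph_consVec {d : ℕ} (t : ℝ) (x y : Fin d → ℝ) :
    hyperplaneGraph (consVec t x) y = consVec (-(x ⬝ᵥ y) / t) y := by
  simp [hyperplaneGraph, consVec, dotProduct]

theorem lintegral_eq_lintegral_consVec {d : ℕ} {G : En (d + 1) → ℝ≥0∞} (hG : Measurable G) :
    ∫⁻ v, G v = ∫⁻ x : Fin d → ℝ, ∫⁻ t : ℝ, G (consVec t x) := by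
  have h1 := (PiLp.volume_preserving_toLp (Fin (d + 1))).lintegral_comp hG
  have h2 := (volume_preserving_piFinSuccAbove (fun _ : Fin (d + 1) => ℝ) 0).symm.lintegral_comp
    (hG.comp (WithLp.measurable_toLp 2 _))
  refine h1.symm.trans (h2.symm.trans ?_)
  have h3 : ∀ z : ℝ × (Fin d → ℝ), (G ∘ WithLp.toLp 2)
      ((MeasurableEquiv.piFinSuccAbove (fun _ : Fin (d + 1) => ℝ) 0).symm z) =
      G (consVec z.1 z.2) := fun z => by
    simp [consVec, MeasurableEquiv.piFinSuccAbove_symm_apply]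
    rfl
  simp only [h3]
  exact lintegral_prod_symm' (μ := (volume : Measure ℝ)) (ν := (volume : Measure (Fin d → ℝ)))
    (fun z => G (consVec z.1 z.2)) (by fun_prop)

theorem ae_apply_zero_ne_zero (d : ℕ) : ∀ᵐ h : En (d + 1), h 0 ≠ 0 := by
  let π : En (d + 1) →ₗ[ℝ] ℝ := (EuclideanSpace.proj (0 : Fin (d + 1)) : En (d + 1) →L[ℝ] ℝ)
  have : LinearMap.ker π ≠ ⊤ := by
    intro h
    have h1 : EuclideanSpace.single (0 : Fin (d + 1)) (1 : ℝ) ∈ LinearMap.ker π :=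
      h ▸ Submodule.mem_top
    simp [π] at h1
  exact measure_eq_zero_iff_ae_notMem.1 (Measure.addHaar_submodule volume _ this)

theorem ae_dotProduct_ne_zero {d : ℕ} {x : Fin d → ℝ} (hx : x ≠ 0) :
    ∀ᵐ y : Fin d → ℝ, x ⬝ᵥ y ≠ 0 := by
  have : LinearMap.ker (dotProductBilin ℝ ℝ x) ≠ ⊤ := by
    intro h
    have h1 : x ∈ LinearMap.ker (dotProductBilin ℝ ℝ x) := h ▸ Submodule.mem_top
    exact hx (dotProduct_self_eq_zero.1 h1)
  exact measure_eq_zero_iff_ae_notMem.1 (Measure.addHaar_submodule volume _ this)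

theorem lintegral_lintegral_hyperplane {d : ℕ} {F : En (d + 1) → En (d + 1) → ℝ≥0∞}
    (hF : Measurable (Function.uncurry F)) :
    ∫⁻ h, ∫⁻ w in {w | ⟪w, h⟫ = 0}, F h w ∂μH[(d : ℝ)] =
      hausdorffScale d * ∫⁻ x : Fin d → ℝ, ∫⁻ y : Fin d → ℝ, ∫⁻ t : ℝ, ENNReal.ofReal |t|⁻¹ *
        (ENNReal.ofReal ‖consVec t x‖ * F (consVec t x) (consVec (-(x ⬝ᵥ y) / t) y)) := by
  have h1 : ∀ᵐ h : En (d + 1), ∫⁻ w in {w | ⟪w, h⟫ = 0}, F h w ∂μH[(d : ℝ)] =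
      hausdorffScale d * ∫⁻ y : Fin d → ℝ, ENNReal.ofReal (‖h‖ / |h 0|) *
        F h (consVec (-((fun k : Fin d => h k.succ) ⬝ᵥ y) / h 0) y) := by
    filter_upwards [ae_apply_zero_ne_zero d] with h hh
    rw [lintegral_hyperplane_eq_lintegral_graph hh (hF.of_uncurry_left (x := h)),
      lintegral_const_mul' _ _ ENNReal.ofReal_ne_top]
    rfl
  have hm : Measurable fun z : En (d + 1) × (Fin d → ℝ) => ENNReal.ofReal (‖z.1‖ / |z.1 0|) *
      F z.1 (consVec (-((fun k : Fin d => z.1 k.succ) ⬝ᵥ z.2) / z.1 0) z.2) := by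
    refine Measurable.mul (by fun_prop) (hF.comp (measurable_fst.prodMk ?_))
    simp only [dotProduct]
    fun_prop
  rw [lintegral_congr_ae h1, lintegral_const_mul' _ _ ENNReal.coe_ne_top,
    lintegral_eq_lintegral_consVec hm.lintegral_prod_right']
  congr 1
  refine lintegral_congr fun x => ?_
  have hm' : Measurable fun z : ℝ × (Fin d → ℝ) => (consVec z.1 x, z.2) := by fun_prop
  refine (lintegral_lintegral_swap (f := fun (t : ℝ) (y : Fin d → ℝ) =>
    ENNReal.ofReal (‖consVec t x‖ / |consVec t x 0|) * F (consVec t x)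
      (consVec (-((fun k : Fin d => consVec t x k.succ) ⬝ᵥ y) / consVec t x 0) y))
    (hm.comp hm').aemeasurable).trans ?_
  refine lintegral_congr fun y => lintegral_congr fun t => ?_
  rw [← mul_assoc, ← ENNReal.ofReal_mul (inv_nonneg.2 (abs_nonneg t)), div_eq_inv_mul]
  rfl

/-- Interchange of the order of integration over pairs of orthogonal vectors. -/
theorem lintegral_lintegral_hyperplane_swap {d : ℕ} (hd : 1 ≤ d)
    {F : En (d + 1) → En (d + 1) → ℝ≥0∞} (hF : Measurable (Function.uncurry F)) :
    ∫⁻ h, ∫⁻ w in {w | ⟪w, h⟫ = 0}, F h w ∂μH[(d : ℝ)] =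
      ∫⁻ w, ∫⁻ h in {h | ⟪h, w⟫ = 0}, F h w * ENNReal.ofReal (‖h‖ / ‖w‖) ∂μH[(d : ℝ)] := by
  have hm : Measurable fun z : ((Fin d → ℝ) × (Fin d → ℝ)) × ℝ => ENNReal.ofReal |z.2|⁻¹ *
      (ENNReal.ofReal ‖consVec z.2 z.1.1‖ *
        (F (consVec (-(z.1.1 ⬝ᵥ z.1.2) / z.2) z.1.2) (consVec z.2 z.1.1) *
          ENNReal.ofReal (‖consVec (-(z.1.1 ⬝ᵥ z.1.2) / z.2) z.1.2‖ / ‖consVec z.2 z.1.1‖))) := by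
    have h1 : Measurable fun z : ((Fin d → ℝ) × (Fin d → ℝ)) × ℝ =>
        consVec (-(z.1.1 ⬝ᵥ z.1.2) / z.2) z.1.2 := by
      simp only [dotProduct]
      fun_prop
    have h2 := hF.comp (h1.prodMk (f := fun z : ((Fin d → ℝ) × (Fin d → ℝ)) × ℝ =>
        consVec (-(z.1.1 ⬝ᵥ z.1.2) / z.2) z.1.2)
      (g := fun z => consVec z.2 z.1.1) (by fun_prop))
    simp only [Function.comp_def, Function.uncurry] at h2
    fun_prop
  rw [lintegral_lintegral_hyperplane hF,
    lintegral_lintegral_hyperplane (F := fun w h => F h w * ENNReal.ofReal (‖h‖ / ‖w‖))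
      (by
        refine Measurable.mul (hF.comp measurable_swap) ?_
        fun_prop)]
  congr 1
  refine Eq.trans ?_ (lintegral_lintegral_swap hm.lintegral_prod_right'.aemeasurable).symm
  have : Nonempty (Fin d) := ⟨⟨0, hd⟩⟩
  refine lintegral_congr_ae ?_
  filter_upwards [Measure.ae_ne volume (0 : Fin d → ℝ)] with x hx
  refine lintegral_congr_ae ?_
  filter_upwards [ae_dotProduct_ne_zero hx] with y hy
  rw [← lintegral_inv_abs_mul_neg_div hy fun t u =>
    ENNReal.ofReal ‖consVec t x‖ * F (consVec t x) (consVec u y)]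
  refine lintegral_congr_ae ?_
  filter_upwards [Measure.ae_ne volume (0 : ℝ)] with u hu
  have hpos : 0 < ‖consVec u y‖ := by
    refine norm_pos_iff.2 fun h => hu ?_
    simpa [consVec] using congrArg (fun v : En (d + 1) => v 0) h
  rw [dotProduct_comm y x, mul_left_comm (ENNReal.ofReal ‖consVec u y‖),
    ← ENNReal.ofReal_mul hpos.le, mul_div_cancel₀ _ hpos.ne', mul_comm (F _ _)]

theorem setLIntegral_ball_norm_rpow {d : ℕ} (p : ℝ) {R : ℝ} (hR : 0 < R) :
    ∫⁻ y in ball (0 : En d) R, ENNReal.ofReal (‖y‖ ^ (-p)) =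
      ENNReal.ofReal (R ^ ((d : ℝ) - p)) *
        ∫⁻ y in ball (0 : En d) 1, ENNReal.ofReal (‖y‖ ^ (-p)) := by
  have hm : Measurable ((ball (0 : En d) R).indicator fun y => ENNReal.ofReal (‖y‖ ^ (-p))) :=
    Measurable.indicator (by fun_prop) measurableSet_ball
  have h1 := lintegral_map (μ := volume) hm (measurable_const_smul (α := En d) R)
  rw [Measure.map_addHaar_smul volume hR.ne', lintegral_smul_measure] at h1
  have h2 : ∀ x : En d, (ball (0 : En d) R).indicator (fun y => ENNReal.ofReal (‖y‖ ^ (-p)))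
      (R • x) = ENNReal.ofReal (R ^ (-p)) *
        (ball (0 : En d) 1).indicator (fun y => ENNReal.ofReal (‖y‖ ^ (-p))) x := by
    intro x
    have hx : R • x ∈ ball (0 : En d) R ↔ x ∈ ball (0 : En d) 1 := by
      rw [mem_ball_zero_iff, mem_ball_zero_iff, norm_smul, Real.norm_of_nonneg hR.le]
      exact mul_lt_iff_lt_one_right hR
    by_cases h : x ∈ ball (0 : En d) 1
    · rw [indicator_of_mem (hx.2 h), indicator_of_mem h, norm_smul, Real.norm_of_nonneg hR.le,
        Real.mul_rpow hR.le (norm_nonneg _), ENNReal.ofReal_mul (by positivity)]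
    · rw [indicator_of_notMem (mt hx.1 h), indicator_of_notMem h, mul_zero]
  simp only [h2] at h1
  rw [lintegral_const_mul' _ _ ENNReal.ofReal_ne_top, lintegral_indicator measurableSet_ball,
    lintegral_indicator measurableSet_ball, finrank_euclideanSpace_fin, smul_eq_mul,
    abs_of_pos (by positivity)] at h1
  rw [sub_eq_add_neg, Real.rpow_add hR, Real.rpow_natCast, ENNReal.ofReal_mul (by positivity),
    mul_assoc, ← h1, ← mul_assoc, ← ENNReal.ofReal_mul (by positivity),
    mul_inv_cancel₀ (by positivity), ENNReal.ofReal_one, one_mul]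

theorem setLIntegral_ball_norm_rpow_lt_top {d : ℕ} (hd : 1 ≤ d) {p : ℝ} (hp : p < d) :
    ∫⁻ y in ball (0 : En d) 1, ENNReal.ofReal (‖y‖ ^ (-p)) < ∞ := by
  have h := integrableOn_ball_of_norm_le_rpow (μ := (volume : Measure (En d))) (C := 1) (α := p)
    (r := 1) (f := fun y => ‖y‖ ^ (-p)) (by simpa using hd) (by simpa using hp)
    (Filter.Eventually.of_forall fun x => by
      rw [Real.norm_of_nonneg (by positivity), one_mul])
    (Measurable.aestronglyMeasurable (by fun_prop))
  exact (hasFiniteIntegral_iff_ofReal (Filter.Eventually.of_forall fun x => by positivity)).1 h.2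

/-- The profile `r ↦ (1 + r)^{-p}` cut off at radius `R`. -/
def truncProfile (p R r : ℝ) : ℝ≥0∞ :=
  if r < R then ENNReal.ofReal ((1 + r) ^ (-p)) else 0

@[fun_prop]
theorem measurable_truncProfile (p R : ℝ) : Measurable (truncProfile p R) :=
  Measurable.ite measurableSet_Iio (by fun_prop) measurable_const

theorem truncProfile_anti {p R r r' : ℝ} (hp : 0 ≤ p) (hr : 0 ≤ r) (h : r ≤ r') :
    truncProfile p R r' ≤ truncProfile p R r := by
  unfold truncProfile
  split_ifs with h1 h2
  · exact ENNReal.ofReal_le_ofReal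
      (Real.rpow_le_rpow_of_nonpos (by linarith) (by linarith) (by linarith))
  · exact absurd (h.trans_lt h1) h2
  · exact zero_le
  · exact le_rfl

theorem norm_add_le_norm_add_hyperplaneEmbed {d : ℕ}
    (b : OrthonormalBasis (Fin (d + 1)) ℝ (En (d + 1))) (v : En (d + 1)) (y : En d) :
    ‖WithLp.toLp 2 (fun j => b.repr v j.succ) + y‖ ≤ ‖v + hyperplaneEmbed b y‖ := by
  rw [← b.repr.norm_map, map_add, hyperplaneEmbed, LinearIsometryEquiv.apply_symm_apply,
    EuclideanSpace.norm_eq, EuclideanSpace.norm_eq, Fin.sum_univ_succ]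
  apply Real.sqrt_le_sqrt
  simp only [PiLp.add_apply, Fin.cons_succ]
  exact le_add_of_nonneg_left (by positivity)

theorem exists_lintegral_hyperplane_truncProfile_le {d : ℕ} (hd : 1 ≤ d) {p : ℝ} (hp0 : 0 ≤ p)
    (hp : p < d) :
    ∃ K : ℝ≥0, ∀ R : ℝ, 0 < R → ∀ w : En (d + 1), w ≠ 0 → ∀ v : En (d + 1),
      ∫⁻ h in {h | ⟪h, w⟫ = 0}, truncProfile p R ‖v + h‖ ∂μH[(d : ℝ)] ≤
        K * ENNReal.ofReal (R ^ ((d : ℝ) - p)) := by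
  have hfin := setLIntegral_ball_norm_rpow_lt_top hd hp
  refine ⟨hausdorffScale d *
    (∫⁻ y in ball (0 : En d) 1, ENNReal.ofReal (‖y‖ ^ (-p))).toNNReal, fun R hR w hw v => ?_⟩
  obtain ⟨b, hb⟩ := exists_orthonormalBasis_zero_eq hw
  rw [lintegral_hyperplane_eq_lintegral_embed hw hb (by fun_prop), ENNReal.coe_mul,
    ENNReal.coe_toNNReal hfin.ne, mul_assoc]
  gcongr
  calc ∫⁻ y, truncProfile p R ‖v + hyperplaneEmbed b y‖
      ≤ ∫⁻ y : En d, truncProfile p R ‖WithLp.toLp 2 (fun j => b.repr v j.succ) + y‖ :=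
        lintegral_mono fun y => truncProfile_anti hp0 (norm_nonneg _)
          (norm_add_le_norm_add_hyperplaneEmbed b v y)
    _ = ∫⁻ y : En d, truncProfile p R ‖y‖ :=
        lintegral_add_left_eq_self (fun y : En d => truncProfile p R ‖y‖) _
    _ ≤ ∫⁻ y in ball (0 : En d) R, ENNReal.ofReal (‖y‖ ^ (-p)) := by
        rw [← lintegral_indicator measurableSet_ball]
        have : Nonempty (Fin d) := ⟨⟨0, hd⟩⟩
        refine lintegral_mono_ae ?_
        filter_upwards [Measure.ae_ne volume (0 : En d)] with y hy
        have hy0 : 0 < ‖y‖ := norm_pos_iff.2 hy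
        unfold truncProfile
        split_ifs with h
        · rw [indicator_of_mem (mem_ball_zero_iff.2 h)]
          exact ENNReal.ofReal_le_ofReal
            (Real.rpow_le_rpow_of_nonpos hy0 (by linarith) (by linarith))
        · exact zero_le
    _ = _ := by rw [setLIntegral_ball_norm_rpow p hR, mul_comm]

theorem lintegral_translate_mul_norm_rpow_le {n : ℕ} {f : En n → ℝ} (hf : Measurable f)
    (hf0 : ∀ v, 0 ≤ f v) {M₀ Mq q a R : ℝ} (ha : 0 ≤ a) (haq : a ≤ q) (hR : 1 ≤ R)
    (hM₀ : (∫⁻ v, ENNReal.ofReal (f v)) ≤ ENNReal.ofReal M₀) (hMq : MomentBound f q Mq)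
    {v : En n} (hv : ‖v‖ ≤ R) :
    ∫⁻ w, ENNReal.ofReal (f (v + w) * ‖w‖ ^ a) ≤
      ENNReal.ofReal (R ^ a * 2 ^ q * (max M₀ 0 + max Mq 0)) := by
  have hpt : ∀ z : En n, f z * ‖z - v‖ ^ a ≤ R ^ a * 2 ^ q * (f z + f z * ‖z‖ ^ q) := by
    intro z
    have hz := norm_nonneg z
    have h1 : ‖z - v‖ ≤ R * (1 + ‖z‖) := by
      nlinarith [norm_sub_le z v]
    have h2 : (1 + ‖z‖) ^ q ≤ 2 ^ q * (1 + ‖z‖ ^ q) := by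
      have hq : 0 ≤ q := ha.trans haq
      rcases le_total ‖z‖ 1 with h | h
      · calc (1 + ‖z‖) ^ q ≤ 2 ^ q := by gcongr; linarith
          _ ≤ _ := le_mul_of_one_le_right (by positivity)
            (le_add_of_nonneg_right (by positivity))
      · calc (1 + ‖z‖) ^ q ≤ (2 * ‖z‖) ^ q := by gcongr; linarith
          _ = 2 ^ q * ‖z‖ ^ q := Real.mul_rpow (by norm_num) hz
          _ ≤ _ := by gcongr; linarith
    have h3 : ‖z - v‖ ^ a ≤ R ^ a * (2 ^ q * (1 + ‖z‖ ^ q)) :=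
      calc ‖z - v‖ ^ a ≤ (R * (1 + ‖z‖)) ^ a := by gcongr
        _ = R ^ a * (1 + ‖z‖) ^ a := Real.mul_rpow (by positivity) (by positivity)
        _ ≤ R ^ a * (1 + ‖z‖) ^ q := by gcongr; linarith
        _ ≤ _ := by gcongr
    calc f z * ‖z - v‖ ^ a ≤ f z * (R ^ a * (2 ^ q * (1 + ‖z‖ ^ q))) :=
          mul_le_mul_of_nonneg_left h3 (hf0 z)
      _ = _ := by ring
  have hR0 : 0 ≤ R := by linarith
  calc ∫⁻ w, ENNReal.ofReal (f (v + w) * ‖w‖ ^ a)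
      = ∫⁻ w, ENNReal.ofReal (f (v + w) * ‖v + w - v‖ ^ a) := by simp
    _ = ∫⁻ z, ENNReal.ofReal (f z * ‖z - v‖ ^ a) :=
        lintegral_add_left_eq_self (fun z => ENNReal.ofReal (f z * ‖z - v‖ ^ a)) v
    _ ≤ ∫⁻ z, ENNReal.ofReal (R ^ a * 2 ^ q) *
          (ENNReal.ofReal (f z) + ENNReal.ofReal (f z * ‖z‖ ^ q)) := by
        refine lintegral_mono fun z => ?_
        rw [← ENNReal.ofReal_add (hf0 z) (mul_nonneg (hf0 z) (by positivity)),
          ← ENNReal.ofReal_mul (by positivity)]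
        exact ENNReal.ofReal_le_ofReal (hpt z)
    _ = ENNReal.ofReal (R ^ a * 2 ^ q) * ((∫⁻ z, ENNReal.ofReal (f z)) +
          ∫⁻ z, ENNReal.ofReal (f z * ‖z‖ ^ q)) := by
        rw [lintegral_const_mul' _ _ ENNReal.ofReal_ne_top, lintegral_add_left (by fun_prop)]
    _ ≤ ENNReal.ofReal (R ^ a * 2 ^ q) * (ENNReal.ofReal (max M₀ 0) +
          ENNReal.ofReal (max Mq 0)) := by
        gcongr
        · exact hM₀.trans (ENNReal.ofReal_le_ofReal (le_max_left _ _))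
        · exact hMq.trans (ENNReal.ofReal_le_ofReal (le_max_left _ _))
    _ = _ := by
        rw [← ENNReal.ofReal_add (le_max_right _ _) (le_max_right _ _),
          ← ENNReal.ofReal_mul (by positivity)]

/-- Pointwise bound for the integrand after interchanging the integrals: here `x` and `y` stand for
the norms of the two orthogonal vectors, `u` for that of their base point shifted by the first. -/
theorem kernel_integrand_le {d s a p N R x y u fh fw : ℝ} (hd : 0 ≤ d) (hs : s ∈ Ioo (0 : ℝ) 1)
    (hR : 0 < R) (hx : R / 8 ≤ x) (hy : 0 < y) (hu : 0 ≤ u) (hfh : 0 ≤ fh) (hfw : 0 ≤ fw)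
    (hN : (1 + u) ^ p * fh ≤ N) :
    fh * ((1 - s) * x ^ (-(d + 1) - 2 * s)) * (fw * y ^ (a + 1)) * (x / y) ≤
      fw * y ^ a * (N * (8 ^ (d + 2) * R ^ (-d - 2 * s))) * (1 + u) ^ (-p) := by
  obtain ⟨hs0, hs1⟩ := hs
  have hx0 : 0 < x := by linarith
  have h1 : x ^ (-(d + 1) - 2 * s) * x = x ^ (-d - 2 * s) := by
    rw [← Real.rpow_add_one hx0.ne']
    ring_nf
  have h2 : x ^ (-d - 2 * s) ≤ 8 ^ (d + 2) * R ^ (-d - 2 * s) := by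
    calc x ^ (-d - 2 * s) ≤ (R / 8) ^ (-d - 2 * s) :=
          Real.rpow_le_rpow_of_nonpos (by positivity) hx (by linarith)
      _ = 8 ^ (d + 2 * s) * R ^ (-d - 2 * s) := by
          rw [Real.div_rpow hR.le (by norm_num), div_eq_mul_inv, ← Real.rpow_neg (by norm_num),
            mul_comm]
          ring_nf
      _ ≤ _ := by
          gcongr
          · norm_num
          · linarith
  have h3 : fh ≤ N * (1 + u) ^ (-p) := by
    rw [Real.rpow_neg (by positivity), ← div_eq_mul_inv, le_div_iff₀ (by positivity), mul_comm]
    exact hN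
  have h4 : y ^ (a + 1) = y ^ a * y := Real.rpow_add_one hy.ne' a
  have h5 : (1 - s) * x ^ (-d - 2 * s) ≤ 8 ^ (d + 2) * R ^ (-d - 2 * s) :=
    (mul_le_of_le_one_left (by positivity) (by linarith)).trans h2
  calc fh * ((1 - s) * x ^ (-(d + 1) - 2 * s)) * (fw * y ^ (a + 1)) * (x / y)
      = fw * y ^ a * (fh * ((1 - s) * x ^ (-d - 2 * s))) := by
        rw [h4, ← h1]
        field_simp
    _ ≤ fw * y ^ a * ((N * (1 + u) ^ (-p)) * (8 ^ (d + 2) * R ^ (-d - 2 * s))) := by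
        have : 0 ≤ 1 - s := by linarith
        have : 0 ≤ N * (1 + u) ^ (-p) := hfh.trans h3
        gcongr
    _ = _ := by ring

/-- Lemma 6.3 of the paper, extended to small `p`: for `p ∈ [0, n-1)` and
`v ∈ B₁(v₀)`, over `M = {h : |v+h| < |v₀|/8, |h| > 1/2 + |v₀|/8}` one has
`∫_M f(v+h) K_f(v,v+h) dh ≤ C (1+|v₀|)^{-p+γ} N`, where `N` bounds `(1+|v|)^p f(v)`, with `C`
depending only on `n, p, γ, M₀, M_q, q` (independent of `v₀` and `s`). -/
theorem stmt12 (n : ℕ) (hn : 2 ≤ n) (γ q p M₀ Mq : ℝ)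
    (hγ : -(n : ℝ) < γ) (hq : 2 ≤ q) (hp0 : 0 ≤ p) (hpn : p < (n : ℝ) - 1) :
    ∃ C : ℝ, 0 < C ∧
      ∀ s : ℝ, s ∈ Set.Ioo (0:ℝ) 1 → 0 ≤ γ + 2*s → γ + 2*s ≤ q →
        ∀ (N : ℝ) (f : En n → ℝ), Measurable f → (∀ v, 0 ≤ f v) →
          (∫⁻ v, ENNReal.ofReal (f v)) ≤ ENNReal.ofReal M₀ →
          MomentBound f q Mq →
          (∀ v, (1 + ‖v‖) ^ p * f v ≤ N) →
          ∀ v₀ v : En n, v ∈ Metric.ball v₀ 1 →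
            (∫⁻ h in {h : En n | ‖v + h‖ < ‖v₀‖ / 8 ∧ 1/2 + ‖v₀‖ / 8 < ‖h‖},
                ENNReal.ofReal (f (v + h)) * KfE n s γ f v (v + h)) ≤
              ENNReal.ofReal (C * (1 + ‖v₀‖) ^ (-p + γ) * N) := by
  obtain ⟨d, rfl⟩ : ∃ d, n = d + 1 := ⟨n - 1, by omega⟩
  have hd : 1 ≤ d := by omega
  have hcast : ((d + 1 : ℕ) : ℝ) - 1 = d := by push_cast; ring
  rw [hcast] at hpn
  obtain ⟨K, hK⟩ := exists_lintegral_hyperplane_truncProfile_le hd hp0 hpn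
  have hM : 0 ≤ max M₀ 0 + max Mq 0 := add_nonneg (le_max_right _ _) (le_max_right _ _)
  refine ⟨2 ^ q * (max M₀ 0 + max Mq 0) * 8 ^ ((d : ℝ) + 2) * K + 1, by positivity, ?_⟩
  intro s hs ha haq N f hf hf0 hM₀ hMq hN v₀ v hv
  obtain ⟨R, hR⟩ : ∃ R, R = 1 + ‖v₀‖ := ⟨_, rfl⟩
  have hR1 : 1 ≤ R := by linarith [norm_nonneg v₀]
  have hR0 : 0 < R := by linarith
  have hN0 : 0 ≤ N := (mul_nonneg (by positivity) (hf0 0)).trans (hN 0)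
  have hvR : ‖v‖ ≤ R := by
    have h1 : ‖v - v₀‖ < 1 := mem_ball_iff_norm.1 hv
    linarith [norm_le_norm_add_norm_sub' v v₀]
  set M := {h : En (d + 1) | ‖v + h‖ < ‖v₀‖ / 8 ∧ 1 / 2 + ‖v₀‖ / 8 < ‖h‖} with hMdef
  have hMmeas : MeasurableSet M := by
    rw [hMdef, ofPred_and]
    exact (measurableSet_lt (by fun_prop) (by fun_prop)).inter
      (measurableSet_lt (by fun_prop) (by fun_prop))
  let φ : En (d + 1) → ℝ≥0∞ := M.indicator fun h =>
    ENNReal.ofReal (f (v + h) * ((1 - s) * ‖h‖ ^ (-((d : ℝ) + 1) - 2 * s)))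
  let ψ : En (d + 1) → ℝ≥0∞ := fun w => ENNReal.ofReal (f (v + w) * ‖w‖ ^ (γ + 2 * s + 1))
  have hφ : Measurable φ := Measurable.indicator (by fun_prop) hMmeas
  have hψ : Measurable ψ := by fun_prop
  have hφtop : ∀ h, φ h ≠ ∞ := fun h => by
    simp only [φ, indicator_apply]
    split_ifs <;> simp
  have hstart : (∫⁻ h in M, ENNReal.ofReal (f (v + h)) * KfE (d + 1) s γ f v (v + h)) =
      ∫⁻ h, ∫⁻ w in {w | ⟪w, h⟫ = 0}, φ h * ψ w ∂μH[(d : ℝ)] := by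
    rw [← lintegral_indicator hMmeas]
    refine lintegral_congr fun h => ?_
    rw [lintegral_const_mul' _ _ (hφtop h)]
    by_cases hh : h ∈ M
    · simp only [φ, indicator_of_mem hh]
      rw [KfE, add_sub_cancel_left, hcast, ← mul_assoc, ← ENNReal.ofReal_mul (hf0 _)]
      push_cast
      rfl
    · simp [φ, indicator_of_notMem hh]
  have hinner : ∀ w : En (d + 1), w ≠ 0 →
      ∫⁻ h in {h | ⟪h, w⟫ = 0}, φ h * ψ w * ENNReal.ofReal (‖h‖ / ‖w‖) ∂μH[(d : ℝ)] ≤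
        ENNReal.ofReal (f (v + w) * ‖w‖ ^ (γ + 2 * s)) *
          ENNReal.ofReal (N * (8 ^ ((d : ℝ) + 2) * R ^ (-(d : ℝ) - 2 * s)) *
            (K * R ^ ((d : ℝ) - p))) := by
    intro w hw
    have hpt : ∀ h, φ h * ψ w * ENNReal.ofReal (‖h‖ / ‖w‖) ≤
        ENNReal.ofReal (f (v + w) * ‖w‖ ^ (γ + 2 * s) *
          (N * (8 ^ ((d : ℝ) + 2) * R ^ (-(d : ℝ) - 2 * s)))) * truncProfile p R ‖v + h‖ := by
      intro h
      by_cases hh : h ∈ M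
      · have h1 : ‖v + h‖ < R := by linarith [hh.1, norm_nonneg v₀]
        have h2 : R / 8 ≤ ‖h‖ := by linarith [hh.2]
        have h3 : 0 ≤ 1 - s := by linarith [hs.2]
        have h4 := hf0 (v + h)
        have h5 := hf0 (v + w)
        simp only [φ, ψ, indicator_of_mem hh, truncProfile, if_pos h1]
        rw [← ENNReal.ofReal_mul (by positivity), ← ENNReal.ofReal_mul (by positivity),
          ← ENNReal.ofReal_mul (by positivity)]
        exact ENNReal.ofReal_le_ofReal (kernel_integrand_le d.cast_nonneg hs hR0 h2
          (norm_pos_iff.2 hw) (norm_nonneg _) h4 h5 (hN _))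
      · simp [φ, indicator_of_notMem hh]
    refine (lintegral_mono hpt).trans ?_
    rw [lintegral_const_mul' _ _ ENNReal.ofReal_ne_top,
      ENNReal.ofReal_mul (mul_nonneg (hf0 _) (by positivity)), mul_assoc,
      ENNReal.ofReal_mul (p := N * _) (by positivity), ENNReal.ofReal_mul K.coe_nonneg,
      ENNReal.ofReal_coe_nnreal]
    gcongr
    exact hK R hR0 w hw v
  rw [hstart, lintegral_lintegral_hyperplane_swap hd (F := fun h w => φ h * ψ w) (by fun_prop)]
  calc ∫⁻ w, ∫⁻ h in {h | ⟪h, w⟫ = 0}, φ h * ψ w * ENNReal.ofReal (‖h‖ / ‖w‖) ∂μH[(d : ℝ)]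
      ≤ ∫⁻ w, ENNReal.ofReal (f (v + w) * ‖w‖ ^ (γ + 2 * s)) *
          ENNReal.ofReal (N * (8 ^ ((d : ℝ) + 2) * R ^ (-(d : ℝ) - 2 * s)) *
            (K * R ^ ((d : ℝ) - p))) :=
        lintegral_mono_ae ((Measure.ae_ne volume 0).mono hinner)
    _ = (∫⁻ w, ENNReal.ofReal (f (v + w) * ‖w‖ ^ (γ + 2 * s))) *
          ENNReal.ofReal (N * (8 ^ ((d : ℝ) + 2) * R ^ (-(d : ℝ) - 2 * s)) *
            (K * R ^ ((d : ℝ) - p))) := lintegral_mul_const' _ _ ENNReal.ofReal_ne_top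
    _ ≤ ENNReal.ofReal (R ^ (γ + 2 * s) * 2 ^ q * (max M₀ 0 + max Mq 0)) *
          ENNReal.ofReal (N * (8 ^ ((d : ℝ) + 2) * R ^ (-(d : ℝ) - 2 * s)) *
            (K * R ^ ((d : ℝ) - p))) := by
        gcongr
        exact lintegral_translate_mul_norm_rpow_le hf hf0 ha haq hR1 hM₀ hMq hvR
    _ ≤ _ := by
        rw [← ENNReal.ofReal_mul (by positivity), ← hR]
        refine ENNReal.ofReal_le_ofReal ?_
        have hpow : R ^ (γ + 2 * s) * R ^ (-(d : ℝ) - 2 * s) * R ^ ((d : ℝ) - p) =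
            R ^ (-p + γ) := by
          rw [← Real.rpow_add hR0, ← Real.rpow_add hR0]
          ring_nf
        have hnn : 0 ≤ R ^ (-p + γ) * N := by positivity
        calc _ = 2 ^ q * (max M₀ 0 + max Mq 0) * 8 ^ ((d : ℝ) + 2) * K *
              (R ^ (γ + 2 * s) * R ^ (-(d : ℝ) - 2 * s) * R ^ ((d : ℝ) - p)) * N := by ring
          _ ≤ _ := by
            rw [hpow]
            linarith
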